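/- arXiv:2412.01060 — 3 statements merged into one kernel-verified Lean document; each statement's English description precedes it below -/
import Mathlib

section
/- For the projective space P^n over a field k and integers 0 ≤ p ≤ n and ℓ > p, the dimension of H^0(P^n, Ω^p(ℓ)) equals binom(ℓ + n − p, ℓ)·binom(ℓ − 1, p). -/
open MvPolynomial

/-- The Euler contraction map on homogeneous `p`-forms of degree `ℓ` on `ℙⁿ`.
A global section of `Ωᵖ_{ℙⁿ}(ℓ)` is a form `ω = ∑_I f_I dx_I` (`I` a `p`-subset of
`{0, …, n}`, `f_I` homogeneous of degree `ℓ − p`) killed by contraction against the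
Euler vector field `∑ xᵢ ∂/∂xᵢ`; indeed `Ωᵖ(ℓ)` is the kernel of the (twisted) Koszul
contraction `⋀ᵖ(O(−1)^{n+1})(ℓ) → ⋀^{p−1}(O(−1)^{n+1})(ℓ)` and `H⁰` is left exact. -/
noncomputable def eulerContraction (k : Type*) [Field k] (n p ℓ : ℕ) :
    ({s : Finset (Fin (n + 1)) // s.card = p} →
        homogeneousSubmodule (Fin (n + 1)) k (ℓ - p)) →ₗ[k]
      (Finset (Fin (n + 1)) → MvPolynomial (Fin (n + 1)) k) :=
  LinearMap.pi fun J =>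
    ∑ i ∈ Jᶜ,
      if h : (insert i J).card = p then
        ((-1 : k) ^ (J.filter (· < i)).card) •
          ((LinearMap.mulLeft k (X i)) ∘ₗ
            (homogeneousSubmodule (Fin (n + 1)) k (ℓ - p)).subtype ∘ₗ
            LinearMap.proj ⟨insert i J, h⟩)
      else 0

namespace BottAux

variable {k : Type*} [Field k] {n : ℕ}

noncomputable def sg (k : Type*) [Field k] {n : ℕ} (J : Finset (Fin (n + 1))) (i : Fin (n + 1)) : k :=
  (-1 : k) ^ (J.filter (· < i)).card

noncomputable def D (f : Finset (Fin (n + 1)) → MvPolynomial (Fin (n + 1)) k)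
    (J : Finset (Fin (n + 1))) : MvPolynomial (Fin (n + 1)) k :=
  ∑ i ∈ Jᶜ, sg k J i • (X i * f (insert i J))

noncomputable def ext (k : Type*) [Field k] (n p d : ℕ) :
    ({s : Finset (Fin (n + 1)) // s.card = p} →
        homogeneousSubmodule (Fin (n + 1)) k d) →ₗ[k]
      (Finset (Fin (n + 1)) → MvPolynomial (Fin (n + 1)) k) :=
  LinearMap.pi fun J => if h : J.card = p then
    (homogeneousSubmodule (Fin (n + 1)) k d).subtype ∘ₗ LinearMap.proj ⟨J, h⟩ else 0

lemma ext_of (p d : ℕ) (v) (J) (h : J.card = p) : ext k n p d v J = v ⟨J, h⟩ := by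
  simp [ext, h]

lemma ext_not (p d : ℕ) (v) (J) (h : J.card ≠ p) : ext k n p d v J = 0 := by
  simp [ext, h]

lemma ext_inj (p d : ℕ) : Function.Injective (ext k n p d) := by
  intro v w h
  funext ⟨J, hJ⟩
  have := congrFun h J
  rw [ext_of _ _ _ _ hJ, ext_of _ _ _ _ hJ] at this
  exact Subtype.ext this

lemma euler_eq (p ℓ : ℕ) (v) : eulerContraction k n p ℓ v = D (ext k n p (ℓ - p) v) := by
  funext J
  simp only [eulerContraction, D, LinearMap.pi_apply, LinearMap.sum_apply]
  refine Finset.sum_congr rfl fun i hi => ?_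
  split_ifs with h
  · rw [ext_of _ _ _ _ h]; simp [sg]
  · rw [ext_not _ _ _ _ h]; simp

lemma mem_ext (p d : ℕ) (f : Finset (Fin (n + 1)) → MvPolynomial (Fin (n + 1)) k)
    (h0 : ∀ J, J.card ≠ p → f J = 0) (h1 : ∀ J, (f J).IsHomogeneous d) :
    ∃ v, ext k n p d v = f := by
  refine ⟨fun J => ⟨f J.1, h1 J.1⟩, ?_⟩
  funext J
  by_cases h : J.card = p
  · rw [ext_of _ _ _ _ h]
  · rw [ext_not _ _ _ _ h, h0 _ h]

lemma ext_hom (p d : ℕ) (v) (J) : (ext k n p d v J).IsHomogeneous d := by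
  by_cases h : J.card = p
  · rw [ext_of _ _ _ _ h]; exact (v _).2
  · rw [ext_not _ _ _ _ h]; exact isHomogeneous_zero _ _ _

lemma sg_insert (J : Finset (Fin (n + 1))) (i j : Fin (n + 1)) (hi : i ∉ J) :
    sg k (insert i J) j = (if i < j then -1 else 1) * sg k J j := by
  unfold sg
  rw [Finset.filter_insert]
  split_ifs with h
  · rw [Finset.card_insert_of_notMem (by simp [hi]), pow_succ]; ring
  · simp

lemma sg_min (J : Finset (Fin (n + 1))) (i : Fin (n + 1)) (hi : ∀ j ∈ J, i ≤ j) :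
    sg k J i = 1 := by
  unfold sg
  rw [Finset.filter_false_of_mem]
  · simp
  · intro j hj; simpa using hi j hj

lemma D_D (f : Finset (Fin (n + 1)) → MvPolynomial (Fin (n + 1)) k) : D (D f) = 0 := by
  funext J
  simp only [D, Finset.mul_sum, Finset.smul_sum, Pi.zero_apply]
  rw [Finset.sum_sigma']
  refine Finset.sum_involution (fun a _ => ⟨a.2, a.1⟩) ?_ ?_ ?_ ?_
  · rintro ⟨i, j⟩ h
    simp only [Finset.mem_sigma, Finset.mem_compl, Finset.mem_insert, not_or] at h
    obtain ⟨hi, hji, hj⟩ := h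
    dsimp only
    rw [sg_insert _ _ _ hi, sg_insert _ _ _ hj, Finset.insert_comm]
    rcases lt_or_gt_of_ne hji with h | h
    · rw [if_neg h.not_gt, if_pos h]
      simp only [mul_smul_comm, smul_smul, mul_left_comm (X i) (X j)]
      rw [← add_smul]
      convert zero_smul k _
      ring
    · rw [if_neg h.not_gt, if_pos h]
      simp only [mul_smul_comm, smul_smul, mul_left_comm (X i) (X j)]
      rw [← add_smul]
      convert zero_smul k _
      ring
  · rintro ⟨i, j⟩ h _ he
    simp only [Finset.mem_sigma, Finset.mem_compl, Finset.mem_insert, not_or] at h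
    simp only [Sigma.mk.injEq] at he
    exact h.2.1 he.1
  · rintro ⟨i, j⟩ h
    simp only [Finset.mem_sigma, Finset.mem_compl, Finset.mem_insert, not_or] at h ⊢
    exact ⟨h.2.2, fun e => h.2.1 e.symm, h.1⟩
  · rintro ⟨i, j⟩ h; rfl

/-- existence of truncated polynomial -/
lemma exists_trunc (P : MvPolynomial (Fin (n + 1)) k) (v : Fin (n + 1)) :
    ∃ Q : MvPolynomial (Fin (n + 1)) k,
      (∀ a, (∀ j ∈ a.support, v ≤ j) → coeff a Q = coeff (a + Finsupp.single v 1) P) ∧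
      (∀ a, (∃ j ∈ a.support, j < v) → coeff a Q = 0) := by
  classical
  let R := P.divMonomial (Finsupp.single v 1)
  refine ⟨∑ m ∈ R.support with ∀ j ∈ m.support, v ≤ j, monomial m (coeff m R), ?_, ?_⟩
  · intro a ha
    have hR : coeff a R = coeff (a + Finsupp.single v 1) P := by
      rw [coeff_divMonomial, add_comm a]
    rw [coeff_sum, ← hR]
    simp only [coeff_monomial, Finset.sum_ite_eq', Finset.mem_filter]
    split_ifs with h
    · rfl
    · by_contra h'
      exact h ⟨by simpa using fun e => h' e.symm, ha⟩
  · rintro a ⟨j, hj, hjv⟩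
    rw [coeff_sum]
    simp only [coeff_monomial, Finset.sum_ite_eq', Finset.mem_filter]
    rw [if_neg]
    rintro ⟨-, h⟩
    exact (h j hj).not_gt hjv

lemma exists_homotopy (f : Finset (Fin (n + 1)) → MvPolynomial (Fin (n + 1)) k) :
    ∃ g : Finset (Fin (n + 1)) → MvPolynomial (Fin (n + 1)) k,
      (∀ I a v, v ∈ I → (∀ j ∈ I, v ≤ j) → (∀ j ∈ a.support, v ≤ j) →
        coeff a (g I) = coeff (a + Finsupp.single v 1) (f (I.erase v))) ∧
      (∀ I a v, v ∈ a.support → (∀ j ∈ I, v < j) → coeff a (g I) = 0) ∧ g ∅ = 0 := by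
  classical
  have H : ∀ I : Finset (Fin (n + 1)), ∃ Q : MvPolynomial (Fin (n + 1)) k,
      (∀ a v, v ∈ I → (∀ j ∈ I, v ≤ j) → (∀ j ∈ a.support, v ≤ j) →
        coeff a Q = coeff (a + Finsupp.single v 1) (f (I.erase v))) ∧
      (∀ a v, v ∈ a.support → (∀ j ∈ I, v < j) → coeff a Q = 0) ∧ (I = ∅ → Q = 0) := by
    intro I
    rcases I.eq_empty_or_nonempty with rfl | hI
    · exact ⟨0, by simp, by simp, fun _ => rfl⟩
    · obtain ⟨Q, h1, h2⟩ := exists_trunc (f (I.erase (I.min' hI))) (I.min' hI)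
      refine ⟨Q, ?_, ?_, fun h => absurd h hI.ne_empty⟩
      · intro a v hv hm ha
        have : v = I.min' hI := le_antisymm (hm _ (I.min'_mem hI)) (I.min'_le _ hv)
        subst this
        exact h1 a ha
      · intro a v hv hm
        exact h2 a ⟨v, hv, hm _ (I.min'_mem hI)⟩
  choose g h1 h2 h3 using H
  exact ⟨g, h1, h2, h3 _ rfl⟩

lemma coeff_D (f : Finset (Fin (n + 1)) → MvPolynomial (Fin (n + 1)) k) (J) (m) :
    coeff m (D f J) = ∑ i ∈ Jᶜ, sg k J i *
      (if i ∈ m.support then coeff (m - Finsupp.single i 1) (f (insert i J)) else 0) := by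
  unfold D
  rw [coeff_sum]
  refine Finset.sum_congr rfl fun i _ => ?_
  rw [coeff_smul, coeff_X_mul', smul_eq_mul]

lemma sub_add_single (m : Fin (n + 1) →₀ ℕ) (i) (hi : i ∈ m.support) :
    m - Finsupp.single i 1 + Finsupp.single i 1 = m := by
  apply tsub_add_cancel_of_le
  simp only [Finsupp.single_le_iff]
  have := Finsupp.mem_support_iff.1 hi
  omega

lemma homotopy_eq (f g : Finset (Fin (n + 1)) → MvPolynomial (Fin (n + 1)) k)
    (h1 : ∀ I a v, v ∈ I → (∀ j ∈ I, v ≤ j) → (∀ j ∈ a.support, v ≤ j) →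
        coeff a (g I) = coeff (a + Finsupp.single v 1) (f (I.erase v)))
    (h2 : ∀ I a v, v ∈ a.support → (∀ j ∈ I, v < j) → coeff a (g I) = 0)
    (hf : D f = 0) (J : Finset (Fin (n + 1))) (m : Fin (n + 1) →₀ ℕ)
    (hne : (m.support ∪ J).Nonempty) : coeff m (D g J) = coeff m (f J) := by
  classical
  obtain ⟨v, hv, hmin⟩ : ∃ v ∈ m.support ∪ J, ∀ j ∈ m.support ∪ J, v ≤ j :=
    ⟨_, Finset.min'_mem _ hne, fun j hj => Finset.min'_le _ _ hj⟩
  have hm : ∀ j ∈ m.support, v ≤ j := fun j hj => hmin j (Finset.mem_union_left _ hj)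
  have hJ : ∀ j ∈ J, v ≤ j := fun j hj => hmin j (Finset.mem_union_right _ hj)
  have hsub : ∀ i, (m - Finsupp.single i 1).support ⊆ m.support := by
    intro i j hj
    simp only [Finsupp.mem_support_iff, Finsupp.coe_tsub, Pi.sub_apply] at hj ⊢
    omega
  rw [coeff_D]
  by_cases hvJ : v ∈ J
  · have e := congrArg (coeff (m + Finsupp.single v 1)) (congrFun hf (J.erase v))
    rw [coeff_D] at e
    have hc : (J.erase v)ᶜ = insert v Jᶜ := by
      rw [Finset.compl_erase]
    rw [hc, Finset.sum_insert (by simpa using hvJ), Finset.insert_erase hvJ,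
      sg_min _ _ (fun j hj => hJ j (Finset.mem_of_mem_erase hj)), if_pos (by simp),
      add_tsub_cancel_right, one_mul, Pi.zero_apply, coeff_zero] at e
    rw [eq_neg_of_add_eq_zero_left e, ← Finset.sum_neg_distrib]
    refine Finset.sum_congr rfl fun i hi => ?_
    rw [Finset.mem_compl] at hi
    have hiv : i ≠ v := fun h => hi (h ▸ hvJ)
    have hsup : i ∈ (m + Finsupp.single v 1).support ↔ i ∈ m.support := by
      simp [Finsupp.single_apply, hiv.symm]
    by_cases him : i ∈ m.support
    · have hlt : v < i := lt_of_le_of_ne (hm i him) hiv.symm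
      rw [if_pos him, if_pos (hsup.2 him),
        h1 _ _ v (by simp [hvJ]) (by
          intro j hj
          rcases Finset.mem_insert.1 hj with rfl | hj
          · exact hlt.le
          · exact hJ j hj) (fun j hj => hm j (hsub i hj)),
        Finset.erase_insert_of_ne hiv]
      have hs : sg k J i = - sg k (J.erase v) i := by
        conv_lhs => rw [← Finset.insert_erase hvJ]
        rw [sg_insert _ _ _ (by simp), if_pos hlt]; ring
      have hmm : m - Finsupp.single i 1 + Finsupp.single v 1
          = m + Finsupp.single v 1 - Finsupp.single i 1 := by
        ext j
        have := Finsupp.mem_support_iff.1 him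
        by_cases hji : j = i
        · subst hji; simp [Finsupp.single_apply, hiv.symm]
        · simp [Finsupp.single_apply, Ne.symm hji]
      rw [hs, hmm]; ring
    · rw [if_neg him, if_neg (fun h => him (hsup.1 h))]; simp
  · have hvm : v ∈ m.support := by
      rcases Finset.mem_union.1 hv with h | h
      · exact h
      · exact absurd h hvJ
    rw [Finset.sum_eq_single_of_mem v (by simpa using hvJ), if_pos hvm, sg_min _ _ hJ, one_mul,
      h1 _ _ v (by simp) (by
          intro j hj
          rcases Finset.mem_insert.1 hj with rfl | hj
          · exact le_rfl
          · exact hJ j hj) (fun j hj => hm j (hsub v hj)), Finset.erase_insert hvJ,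
      sub_add_single _ _ hvm]
    intro i hi hiv
    split_ifs with him
    · rw [h2 _ _ v, mul_zero]
      · have := Finsupp.mem_support_iff.1 hvm
        simpa [Finsupp.single_apply, hiv] using this
      · intro j hj
        rcases Finset.mem_insert.1 hj with rfl | hj
        · exact lt_of_le_of_ne (hm _ him) hiv.symm
        · exact lt_of_le_of_ne (hJ j hj) (fun h => hvJ (h ▸ hj))
    · simp

lemma D_ext_hom (p d : ℕ) (v) (J : Finset (Fin (n + 1))) :
    (D (ext k n p d v) J).IsHomogeneous (d + 1) := by
  unfold D
  refine IsHomogeneous.sum _ _ _ fun i _ => ?_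
  refine (homogeneousSubmodule _ k (d + 1)).smul_mem _ ?_
  rw [add_comm d 1]
  exact (isHomogeneous_X k i).mul (ext_hom p d v _)

lemma D_ext_card (p d : ℕ) (v) (J : Finset (Fin (n + 1))) (hJ : J.card ≠ p) :
    D (ext k n (p + 1) d v) J = 0 := by
  unfold D
  refine Finset.sum_eq_zero fun i hi => ?_
  rw [Finset.mem_compl] at hi
  rw [ext_not, mul_zero, smul_zero]
  rw [Finset.card_insert_of_notMem hi]; omega

lemma exact (p d : ℕ) :
    LinearMap.range (eulerContraction k n (p + 1) (p + 1 + d)) =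
      (LinearMap.ker (eulerContraction k n p (p + 1 + d))).map
        (ext k n p (p + 1 + d - p)) := by
  have e1 : p + 1 + d - p = d + 1 := by omega
  have e2 : p + 1 + d - (p + 1) = d := by omega
  apply le_antisymm
  · rintro _ ⟨v, rfl⟩
    rw [euler_eq]
    obtain ⟨w, hw⟩ := mem_ext p (p + 1 + d - p) (D (ext k n (p + 1) (p + 1 + d - (p + 1)) v))
      (fun J hJ => D_ext_card _ _ _ _ hJ)
      (fun J => by
        have := D_ext_hom _ _ v J
        have e3 : p + 1 + d - (p + 1) + 1 = p + 1 + d - p := by omega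
        rwa [e3] at this)
    refine ⟨w, ?_, hw⟩
    rw [SetLike.mem_coe, LinearMap.mem_ker, euler_eq, hw, D_D]
  · rintro _ ⟨w, hw, rfl⟩
    rw [SetLike.mem_coe, LinearMap.mem_ker, euler_eq] at hw
    obtain ⟨g, h1, h2, h3⟩ := exists_homotopy (ext k n p (p + 1 + d - p) w)
    have key : ∀ I a, coeff a (g I) ≠ 0 → ∃ v ∈ I, coeff (a + Finsupp.single v 1)
        (ext k n p (p + 1 + d - p) w (I.erase v)) ≠ 0 := by
      intro I a h
      rcases I.eq_empty_or_nonempty with rfl | hI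
      · rw [h3] at h; simp at h
      · by_cases ha : ∀ j ∈ a.support, I.min' hI ≤ j
        · rw [h1 I a _ (I.min'_mem hI) (fun j hj => I.min'_le _ hj) ha] at h
          exact ⟨_, I.min'_mem hI, h⟩
        · push Not at ha
          obtain ⟨j, hj, hlt⟩ := ha
          exact absurd (h2 I a j hj fun i hi => hlt.trans_le (I.min'_le _ hi)) h
    obtain ⟨v, hv⟩ := mem_ext (p + 1) (p + 1 + d - (p + 1)) g
      (fun J hJ => by
        ext a
        by_contra h
        obtain ⟨v, hv, h⟩ := key J a h
        rw [ext_not, coeff_zero] at h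
        · exact h rfl
        · rw [Finset.card_erase_of_mem hv]
          have : 0 < J.card := Finset.card_pos.2 ⟨v, hv⟩
          omega)
      (fun J a h => by
        obtain ⟨v, hv, h⟩ := key J a h
        have := ext_hom _ _ w _ h
        rw [map_add, Finsupp.weight_single] at this
        simp at this
        omega)
    refine ⟨v, ?_⟩
    rw [euler_eq, hv]
    funext J
    ext m
    by_cases hne : (m.support ∪ J).Nonempty
    · exact homotopy_eq _ g h1 h2 hw J m hne
    · rw [Finset.not_nonempty_iff_eq_empty, Finset.union_eq_empty, Finsupp.support_eq_empty] at hne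
      obtain ⟨rfl, rfl⟩ := hne
      rw [coeff_D]
      symm
      rw [Finset.sum_eq_zero (by simp)]
      by_contra h
      have := ext_hom _ _ w _ h
      simp at this
      omega

lemma finrank_hom (d : ℕ) :
    Module.finrank k (homogeneousSubmodule (Fin (n + 1)) k d) = (n + d).choose d := by
  rw [homogeneousSubmodule_eq_finsupp_supported]
  have b := basisRestrictSupport (σ := Fin (n + 1)) k {a | a.degree = d}
  have := Module.finrank_eq_nat_card_basis b
  refine this.trans ?_
  have hs : {a : Fin (n + 1) →₀ ℕ | a.degree = d} =
      ((Finset.univ : Finset (Fin (n + 1))).finsuppAntidiag d : Set _) := by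
    ext a
    simp [Finset.mem_finsuppAntidiag, Finsupp.degree_eq_sum]
  rw [hs, Nat.card_coe_set_eq, Set.ncard_coe_finset, Finset.card_finsuppAntidiag_nat_eq_choose]
  simp

instance (d : ℕ) : Module.Finite k (homogeneousSubmodule (Fin (n + 1)) k d) :=
  Module.Finite.iff_fg.2 (homogeneousSubmodule_fg _ _ _)

lemma finrank_V (p d : ℕ) :
    Module.finrank k ({s : Finset (Fin (n + 1)) // s.card = p} →
        homogeneousSubmodule (Fin (n + 1)) k d) = (n + 1).choose p * (n + d).choose d := by
  rw [Module.finrank_pi_fintype]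
  simp [finrank_hom]

lemma recur (p d : ℕ) :
    Module.finrank k (LinearMap.ker (eulerContraction k n p (p + 1 + d))) +
    Module.finrank k (LinearMap.ker (eulerContraction k n (p + 1) (p + 1 + d))) =
      (n + 1).choose (p + 1) * (n + d).choose d := by
  have := LinearMap.finrank_range_add_finrank_ker (eulerContraction k n (p + 1) (p + 1 + d))
  rw [finrank_V, exact,
    ((Submodule.equivMapOfInjective _ (ext_inj (k := k) (n := n) p (p + 1 + d - p)) _).finrank_eq).symm] at this
  rw [this]
  have e : p + 1 + d - (p + 1) = d := by omega
  rw [e]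

lemma ker_zero (ℓ : ℕ) :
    Module.finrank k (LinearMap.ker (eulerContraction k n 0 ℓ)) = (n + ℓ).choose ℓ := by
  have : eulerContraction k n 0 ℓ = 0 := by
    refine LinearMap.ext fun v => ?_
    rw [euler_eq]
    funext J
    simp only [D, LinearMap.zero_apply, Pi.zero_apply]
    refine Finset.sum_eq_zero fun i hi => ?_
    rw [ext_not, mul_zero, smul_zero]
    exact (Finset.card_pos.2 ⟨i, by simp⟩).ne'
  rw [this, LinearMap.ker_zero, finrank_top, finrank_V]
  simp

lemma numeric (p q d : ℕ) :
    (p + 1 + d + (q + 1)).choose (p + 1 + d) * (p + d).choose p +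
      (p + 1 + d + q).choose (p + 1 + d) * (p + d).choose (p + 1) =
    (p + 1 + (q + 1)).choose (p + 1) * (d + (p + q + 1)).choose d := by
  rcases d with _ | e
  · simp
  · have e1 : p + (e + 1) = p + 1 + e := by ring
    have h1 := Nat.cast_add_choose ℚ (a := p + 1 + (e + 1)) (b := q + 1)
    have h2 := Nat.cast_add_choose ℚ (a := p) (b := e + 1)
    have h3 := Nat.cast_add_choose ℚ (a := p + 1 + (e + 1)) (b := q)
    have h4 := Nat.cast_add_choose ℚ (a := p + 1) (b := e)
    have h5 := Nat.cast_add_choose ℚ (a := p + 1) (b := q + 1)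
    have h6 := Nat.cast_add_choose ℚ (a := e + 1) (b := p + q + 1)
    have : ((p + 1 + (e + 1) + (q + 1)).choose (p + 1 + (e + 1)) * (p + (e + 1)).choose p +
      (p + 1 + (e + 1) + q).choose (p + 1 + (e + 1)) * (p + 1 + e).choose (p + 1) : ℚ) =
      (p + 1 + (q + 1)).choose (p + 1) * (e + 1 + (p + q + 1)).choose (e + 1) := by
      rw [h1, h2, h3, h4, h5, h6]
      rw [show p + 1 + (e + 1) + (q + 1) = p + q + e + 2 + 1 by ring,
        show p + 1 + (e + 1) + q = p + q + e + 2 by ring,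
        show e + 1 + (p + q + 1) = p + q + e + 2 by ring,
        show p + 1 + (q + 1) = p + q + 1 + 1 by ring,
        show p + 1 + (e + 1) = p + e + 1 + 1 by ring,
        show p + (e + 1) = p + e + 1 by ring,
        show p + 1 + e = p + e + 1 by ring]
      rw [Nat.factorial_succ (p + q + e + 2), Nat.factorial_succ (p + q + 1),
        Nat.factorial_succ (p + e + 1), Nat.factorial_succ p, Nat.factorial_succ q,
        Nat.factorial_succ e]
      have hf : ∀ m : ℕ, (m.factorial : ℚ) ≠ 0 := fun m => by
        exact_mod_cast m.factorial_ne_zero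
      have a1 := hf (p + q + e + 2)
      have a2 := hf (p + q + 1)
      have a3 := hf (p + e + 1)
      have a4 := hf p
      have a5 := hf q
      have a6 := hf e
      push_cast
      have b1 : (p : ℚ) + 1 ≠ 0 := by positivity
      have b2 : (q : ℚ) + 1 ≠ 0 := by positivity
      have b3 : (e : ℚ) + 1 ≠ 0 := by positivity
      have b4 : (p : ℚ) + e + 1 + 1 ≠ 0 := by positivity
      field_simp
      ring
    rw [e1] at this ⊢
    exact_mod_cast this

end BottAux

/-- Bott formula, `H⁰` case: for `0 ≤ p ≤ n` and `ℓ > p`,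
`dim H⁰(ℙⁿ, Ωᵖ(ℓ)) = C(ℓ + n − p, ℓ) · C(ℓ − 1, p)`, where `H⁰(ℙⁿ, Ωᵖ(ℓ))` is the
space of degree-`ℓ` homogeneous `p`-forms killed by the Euler contraction. -/
theorem bott_formula_H0 (k : Type*) [Field k] (n p ℓ : ℕ) (hp : p ≤ n) (hl : p < ℓ) :
    Module.finrank k (LinearMap.ker (eulerContraction k n p ℓ)) =
      Nat.choose (ℓ + n - p) ℓ * Nat.choose (ℓ - 1) p := by
  induction p with
  | zero => 
    rw [BottAux.ker_zero, add_comm]; simp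
  | succ p ih =>
    obtain ⟨q, rfl⟩ := Nat.exists_eq_add_of_le hp
    obtain ⟨d, rfl⟩ := Nat.exists_eq_add_of_lt hl
    have h1 := ih (by omega) (by omega)
    have h2 := BottAux.recur (k := k) (n := p + 1 + q) p (d + 1)
    have h3 := BottAux.numeric p q (d + 1)
    rw [show p + 1 + d + 1 = p + 1 + (d + 1) by ring] at h1 ⊢
    rw [h1, show p + 1 + (d + 1) + (p + 1 + q) - p = p + 1 + (d + 1) + (q + 1) by omega,
      show p + 1 + (d + 1) - 1 = p + (d + 1) by omega] at h2
    rw [show p + 1 + (d + 1) + (p + 1 + q) - (p + 1) = p + 1 + (d + 1) + q by omega,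
      show p + 1 + (d + 1) - 1 = p + (d + 1) by omega]
    rw [show p + 1 + (q + 1) = p + 1 + q + 1 by ring,
      show d + 1 + (p + q + 1) = p + 1 + q + (d + 1) by ring] at h3
    omega
end

section
/- For integers n ≥ 1 and d ≥ n+1, the inequality 1 + Σ_{r=0}^n binom(d, d−r)·binom(d−r−1, n−r) ≥ 2^{n+1} holds; in particular this quantity strictly exceeds 2^{⌊n/2⌋+1}. -/
/-- For integers `n ≥ 1` and `d ≥ n + 1`, one has
`1 + ∑_{r=0}^n C(d, d−r)·C(d−r−1, n−r) ≥ 2^{n+1}`; in particular this quantity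
strictly exceeds `2^{⌊n/2⌋+1}`. -/
theorem rho_structure_sheaf_lower_bound (n d : ℕ) (hn : 1 ≤ n) (hd : n + 1 ≤ d) :
    2 ^ (n + 1) ≤
      1 + ∑ r ∈ Finset.range (n + 1), Nat.choose d (d - r) * Nat.choose (d - r - 1) (n - r) ∧
    2 ^ (n / 2 + 1) <
      1 + ∑ r ∈ Finset.range (n + 1), Nat.choose d (d - r) * Nat.choose (d - r - 1) (n - r) := by
  have key : 2 ^ (n + 1) ≤
      1 + ∑ r ∈ Finset.range (n + 1), Nat.choose d (d - r) * Nat.choose (d - r - 1) (n - r) := by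
    have h := Nat.sum_range_choose (n + 1)
    rw [Finset.sum_range_succ, Nat.choose_self] at h
    rw [← h, add_comm]
    refine Nat.add_le_add_left (Finset.sum_le_sum fun r hr => ?_) 1
    have hr' : r < n + 1 := Finset.mem_range.mp hr
    rw [Nat.choose_symm (by omega : r ≤ d)]
    have h1 : (n + 1).choose r ≤ d.choose r := Nat.choose_le_choose r hd
    have h2 : 0 < (d - r - 1).choose (n - r) := Nat.choose_pos (by omega)
    exact h1.trans (Nat.le_mul_of_pos_right _ h2)
  refine ⟨key, lt_of_lt_of_le ?_ key⟩
  exact Nat.pow_lt_pow_right (by norm_num) (by omega)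
end

section
/- Let Q be a regular local ring, f ∈ Q nonzero, R = Q/(f), and (F^0, F^1, s^0, s^1) a matrix factorization of f. Then M = coker(s^0) is a maximal Cohen–Macaulay R-module, i.e., depth(M) = dim(R) (when M ≠ 0). -/
lemma add1_le {a b : WithBot ℕ∞} (h : a + 1 ≤ b + 1) : a ≤ b :=
  (WithBot.add_le_add_iff_right' (c := 1) (by decide) (by decide)).mp h

open IsLocalRing in
/-- `Q` has maximal ideal generated by `n` elements and dimension at least `n`. -/
def RegDim (n : ℕ) (Q : Type*) [CommRing Q] [IsLocalRing Q] : Prop :=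
  (∃ v : Fin n → Q, Ideal.span (Set.range v) = maximalIdeal Q) ∧
    ((n : ℕ) : WithBot ℕ∞) ≤ ringKrullDim Q

open IsLocalRing in
lemma RegDim.exists_avoid {n : ℕ} {Q : Type*} [CommRing Q] [IsLocalRing Q] [IsNoetherianRing Q]
    (h : RegDim (n + 1) Q) (I : Ideal Q) (hI : maximalIdeal Q ∉ I.minimalPrimes) :
    ∃ x ∈ maximalIdeal Q, x ∉ maximalIdeal Q ^ 2 ∧ ∀ p ∈ I.minimalPrimes, x ∉ p := by
  classical
  have hfin := Ideal.finite_minimalPrimes_of_isNoetherianRing Q I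
  by_contra! hcon
  have hsub : (maximalIdeal Q : Set Q) ⊆
      ⋃ i ∈ ((insert (maximalIdeal Q ^ 2) hfin.toFinset : Finset (Ideal Q)) : Set (Ideal Q)),
        ((id i : Ideal Q) : Set Q) := by
    intro x hx
    simp only [Set.mem_iUnion]
    by_cases h2 : x ∈ maximalIdeal Q ^ 2
    · exact ⟨_, by simp, h2⟩
    · obtain ⟨p, hp, hxp⟩ := hcon x hx h2
      exact ⟨p, by simp [hp], hxp⟩
  rw [Ideal.subset_union_prime (maximalIdeal Q ^ 2) (maximalIdeal Q ^ 2)] at hsub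
  · obtain ⟨i, hi, hle⟩ := hsub
    simp only [Finset.mem_insert, Set.Finite.mem_toFinset, id] at hi hle
    rcases hi with rfl | hi
    · have hb : maximalIdeal Q = ⊥ := by
        refine Submodule.eq_bot_of_le_smul_of_le_jacobson_bot (maximalIdeal Q) _
          (IsNoetherian.noetherian _) ?_ (maximalIdeal_le_jacobson _)
        rwa [smul_eq_mul, ← pow_two]
      have hF := isField_iff_maximalIdeal_eq.mpr hb
      have h0 := ringKrullDim_eq_zero_of_isField hF
      have h1 := h.2
      rw [h0] at h1
      norm_cast at h1
    · have : i.IsPrime := hi.1.1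
      have : i = maximalIdeal Q := le_antisymm (le_maximalIdeal this.ne_top) hle
      exact hI (this ▸ hi)
  · intro i hi h1 _
    simp only [Finset.mem_insert, Set.Finite.mem_toFinset] at hi
    exact (hi.resolve_left h1).1.1

open IsLocalRing in
lemma bot_mem_minimalPrimes_of_avoid {Q : Type*} [CommRing Q] [IsLocalRing Q] [IsNoetherianRing Q]
    {x : Q} (hx : x ∈ maximalIdeal Q) (hp : (Ideal.span {x}).IsPrime) {I : Ideal Q}
    (hI : I ≤ Ideal.span {x}) (hav : ∀ p ∈ I.minimalPrimes, x ∉ p) : ⊥ ∈ I.minimalPrimes := by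
  obtain ⟨p, hpI, hle⟩ := Ideal.exists_minimalPrimes_le hI
  have hpp : p.IsPrime := hpI.1.1
  have : p = ⊥ := by
    refine Submodule.eq_bot_of_le_smul_of_le_jacobson_bot (maximalIdeal Q) _
          (IsNoetherian.noetherian _) ?_ (maximalIdeal_le_jacobson _)
    intro y hy
    obtain ⟨z, rfl⟩ := Ideal.mem_span_singleton.mp (hle hy)
    exact Submodule.smul_mem_smul hx ((hpp.mem_or_mem hy).resolve_left (hav p hpI))
  exact this ▸ hpI

open IsLocalRing in
lemma RegDim.quotient {n : ℕ} {Q : Type*} [CommRing Q] [IsLocalRing Q] [IsNoetherianRing Q]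
    (h : RegDim (n + 1) Q) {x : Q} (hx : x ∈ maximalIdeal Q) (hx2 : x ∉ maximalIdeal Q ^ 2)
    [IsLocalRing (Q ⧸ Ideal.span {x})] : RegDim n (Q ⧸ Ideal.span {x}) := by
  obtain ⟨⟨v, hv⟩, hd⟩ := h
  constructor
  · have hx' := hx
    rw [← hv, Ideal.mem_span_range_iff_exists_fun] at hx'
    obtain ⟨c, hc⟩ := hx'
    have hvm : ∀ i, v i ∈ maximalIdeal Q := fun i => hv ▸ Ideal.subset_span ⟨i, rfl⟩
    have : ∃ i, IsUnit (c i) := by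
      by_contra! hcon
      apply hx2
      rw [← hc, pow_two]
      exact Ideal.sum_mem _ fun i _ => Ideal.mul_mem_mul ((mem_maximalIdeal _).mpr (hcon i)) (hvm i)
    obtain ⟨i, hi⟩ := this
    let π := Ideal.Quotient.mk (Ideal.span {x})
    refine ⟨fun j => π (v (i.succAbove j)), le_antisymm ?_ ?_⟩
    · rw [Ideal.span_le]
      rintro _ ⟨j, rfl⟩
      have hloc : IsLocalHom π := IsLocalHom.of_surjective π Ideal.Quotient.mk_surjective
      change π (v (i.succAbove j)) ∈ maximalIdeal (Q ⧸ Ideal.span {x})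
      rw [mem_maximalIdeal]
      exact fun hu => (mem_maximalIdeal _).mp (hvm (i.succAbove j)) (hloc.map_nonunit _ hu)
    · have hmap : maximalIdeal (Q ⧸ Ideal.span {x}) ≤ (maximalIdeal Q).map π := by
        intro y hy
        obtain ⟨y, rfl⟩ := Ideal.Quotient.mk_surjective y
        apply Ideal.mem_map_of_mem
        rw [mem_maximalIdeal] at hy ⊢
        exact fun hu => hy (hu.map π)
      refine hmap.trans ?_
      rw [← hv, Ideal.map_span, Ideal.span_le]
      rintro _ ⟨_, ⟨k, rfl⟩, rfl⟩
      have hmem : ∀ j, π (v (i.succAbove j)) ∈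
          Ideal.span (Set.range fun j => π (v (i.succAbove j))) :=
        fun j => Ideal.subset_span ⟨j, rfl⟩
      rcases Fin.eq_self_or_eq_succAbove i k with rfl | ⟨j, rfl⟩
      · have h0 : π x = 0 := Ideal.Quotient.eq_zero_iff_mem.mpr (Ideal.mem_span_singleton_self x)
        replace h0 := (congrArg π hc).trans h0
        rw [Fin.sum_univ_succAbove _ k, map_add, map_sum, map_mul] at h0
        have : π (c k) * π (v k) ∈ Ideal.span (Set.range fun j => π (v (k.succAbove j))) := by
          rw [eq_neg_of_add_eq_zero_left h0]
          refine neg_mem (Ideal.sum_mem _ fun j _ => ?_)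
          rw [map_mul]
          exact Ideal.mul_mem_left _ _ (hmem j)
        exact (Ideal.unit_mul_mem_iff_mem _ (hi.map π)).mp this
      · exact hmem j
  · have h1 := ringKrullDim_le_ringKrullDim_quotient_add_card {x} (R := Q) (by
      simpa [ringJacobson_eq_maximalIdeal] using hx)
    simp only [Finset.card_singleton, Nat.cast_one] at h1
    have h2 := hd.trans h1
    push_cast at h2
    rw [Finset.coe_singleton] at h2
    exact add1_le h2

open IsLocalRing in
lemma isLocalRing_quot {Q : Type*} [CommRing Q] [IsLocalRing Q] {x : Q}
    (hx : x ∈ maximalIdeal Q) : IsLocalRing (Q ⧸ Ideal.span {x}) := by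
  have : Nontrivial (Q ⧸ Ideal.span {x}) := by
    rw [Ideal.Quotient.nontrivial_iff, Ne, Ideal.span_singleton_eq_top]
    exact hx
  exact IsLocalRing.of_surjective' (Ideal.Quotient.mk _) Ideal.Quotient.mk_surjective

open IsLocalRing in
lemma RegDim.isDomain {n : ℕ} : ∀ {Q : Type*} [CommRing Q] [IsLocalRing Q] [IsNoetherianRing Q],
    RegDim n Q → IsDomain Q := by
  induction n with
  | zero =>
    intro Q _ _ _ h
    obtain ⟨⟨v, hv⟩, hd⟩ := h
    have : maximalIdeal Q = ⊥ := by rw [← hv]; simp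
    exact (isField_iff_maximalIdeal_eq.mpr this).isDomain
  | succ n ih =>
    intro Q _ _ _ h
    obtain ⟨x, hx, hx2, hav⟩ := h.exists_avoid ⊥ (by
      intro hm
      have h0 : (maximalIdeal Q).height = 0 := by
        exact Ideal.height_eq_zero_iff.mpr hm
      have h1 := h.2
      rw [← maximalIdeal_height_eq_ringKrullDim, h0] at h1
      norm_cast at h1)
    have := isLocalRing_quot hx
    have hdom := ih (h.quotient hx hx2)
    have hp := (Ideal.Quotient.isDomain_iff_prime _).mp hdom
    have hb := bot_mem_minimalPrimes_of_avoid hx hp bot_le hav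
    have : (⊥ : Ideal Q).IsPrime := hb.1.1
    exact IsDomain.of_bot_isPrime Q

open IsLocalRing RingTheory.Sequence in
lemma mf_aux (n : ℕ) : ∀ (Q : Type*) [CommRing Q] [IsLocalRing Q] [IsNoetherianRing Q]
    (_ : RegDim (n + 1) Q) (f : Q) (_ : f ≠ 0)
    (F0 F1 M : Type*)
    [AddCommGroup F0] [Module Q F0] [Module.Free Q F0]
    [AddCommGroup F1] [Module Q F1] [Module.Free Q F1]
    [AddCommGroup M] [Module Q M]
    (s0 : F0 →ₗ[Q] F1) (s1 : F1 →ₗ[Q] F0) (π : F1 →ₗ[Q] M)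
    (_ : ∀ u, s1 (s0 u) = f • u) (_ : Function.Exact s0 π) (_ : Function.Surjective π),
    ∃ rs : List Q, (∀ r ∈ rs, r ∈ maximalIdeal Q) ∧ IsWeaklyRegular M rs ∧ rs.length = n := by
  induction n with
  | zero =>
    intros
    exact ⟨[], by simp, by simp, rfl⟩
  | succ n ih =>
    intro Q _ _ _ h f hf F0 F1 M _ _ _ _ _ _ _ _ s0 s1 π h10 hex hsurj
    have hdomQ := h.isDomain
    obtain ⟨x, hx, hx2, hav⟩ := h.exists_avoid (Ideal.span {f}) (by
      intro hm
      have h0 := Ideal.height_le_one_of_isPrincipal_of_mem_minimalPrimes _ _ hm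
      have h1 := h.2
      rw [← maximalIdeal_height_eq_ringKrullDim] at h1
      have h2 : ((n + 1 + 1 : ℕ) : ℕ∞) ≤ (maximalIdeal Q).height := by exact_mod_cast h1
      have h3 := h2.trans h0
      norm_cast at h3)
    have := isLocalRing_quot hx
    have hq := h.quotient hx hx2
    have hdom := hq.isDomain
    have hp := (Ideal.Quotient.isDomain_iff_prime _).mp hdom
    have hfx : Ideal.Quotient.mk (Ideal.span {x}) f ≠ 0 := by
      intro h0
      rw [Ideal.Quotient.eq_zero_iff_mem] at h0
      have hb := bot_mem_minimalPrimes_of_avoid hx hp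
        ((Ideal.span_singleton_le_iff_mem _).mpr h0) hav
      exact hf (by simpa using hb.1.2)
    have hx0 : x ≠ 0 := by
      rintro rfl
      exact hx2 (zero_mem _)
    have hs : Function.Surjective (algebraMap Q (Q ⧸ Ideal.span {x})) :=
      Ideal.Quotient.mk_surjective
    obtain ⟨rs, hrs, hreg, hlen⟩ := ih (Q ⧸ Ideal.span {x}) hq _ hfx
      (QuotSMulTop x F0) (QuotSMulTop x F1) (QuotSMulTop x M)
      ((QuotSMulTop.map x s0).extendScalarsOfSurjective hs)
      ((QuotSMulTop.map x s1).extendScalarsOfSurjective hs)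
      ((QuotSMulTop.map x π).extendScalarsOfSurjective hs)
      (by
        intro u
        obtain ⟨u, rfl⟩ := Submodule.Quotient.mk_surjective _ u
        exact congrArg Submodule.Quotient.mk (h10 u))
      (QuotSMulTop.map_exact x hex hsurj)
      (QuotSMulTop.map_surjective x hsurj)
    obtain ⟨rs, rfl⟩ := List.map_surjective_iff.mpr Ideal.Quotient.mk_surjective rs
    refine ⟨x :: rs, ?_, ?_, by simpa using hlen⟩
    · intro r hr
      rcases List.mem_cons.mp hr with rfl | hr
      · exact hx
      · have := hrs _ (List.mem_map_of_mem hr)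
        rw [mem_maximalIdeal] at this ⊢
        exact fun hu => this (hu.map _)
    · refine IsWeaklyRegular.cons' ?_ hreg
      rw [isSMulRegular_iff_right_eq_zero_of_smul]
      intro m hm
      obtain ⟨v, rfl⟩ := hsurj m
      rw [← map_smul] at hm
      obtain ⟨u, hu⟩ := (hex _).mp hm
      have h1 : f • u = x • s1 v := by rw [← h10, hu, map_smul]
      have h2 : Ideal.Quotient.mk (Ideal.span {x}) f •
          (Submodule.Quotient.mk u : QuotSMulTop x F0) = 0 := by
        change (Submodule.Quotient.mk (f • u) : QuotSMulTop x F0) = 0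
        rw [h1, Submodule.Quotient.mk_eq_zero]
        exact Submodule.smul_mem_pointwise_smul _ _ _ trivial
      have h3 := (IsSMulRegular.of_ne_zero hfx).right_eq_zero_of_smul h2
      rw [Submodule.Quotient.mk_eq_zero, Submodule.mem_smul_pointwise_iff_exists] at h3
      obtain ⟨w, -, rfl⟩ := h3
      rw [map_smul] at hu
      have h4 : s0 w = v := (IsSMulRegular.of_ne_zero (M := F1) hx0) hu
      rw [← h4]
      exact (hex _).mpr ⟨w, rfl⟩


/-- Let `Q` be a regular local ring (a Noetherian local ring whose maximal ideal is
generated by `dim Q` elements), `f ≠ 0`, `R = Q/(f)`, and `(F⁰, F¹, s⁰, s¹)` a matrix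
factorization of `f`.  Then `M = coker s⁰` (when `M ≠ 0`) is a maximal Cohen–Macaulay
`R`-module: `depth M = dim R`, i.e. there is an `M`-regular sequence of elements of the
maximal ideal of length equal to `dim R = dim Q − 1`. -/
theorem coker_of_matrixFactorization_is_MCM
    (Q : Type*) [CommRing Q] [IsLocalRing Q] [IsNoetherianRing Q]
    -- `Q` is regular: its maximal ideal is generated by `dim Q` elements
    (hreg : ∃ s : Finset Q, Ideal.span (s : Set Q) = IsLocalRing.maximalIdeal Q ∧
      (s.card : WithBot (WithTop ℕ)) = ringKrullDim Q)
    (f : Q) (hf : f ≠ 0)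
    (F0 F1 : Type*)
    [AddCommGroup F0] [Module Q F0] [Module.Free Q F0] [Module.Finite Q F0]
    [AddCommGroup F1] [Module Q F1] [Module.Free Q F1] [Module.Finite Q F1]
    (s0 : F0 →ₗ[Q] F1) (s1 : F1 →ₗ[Q] F0)
    (h10 : s1 ∘ₗ s0 = f • (LinearMap.id : F0 →ₗ[Q] F0))
    (h01 : s0 ∘ₗ s1 = f • (LinearMap.id : F1 →ₗ[Q] F1))
    -- `M = coker s⁰ ≠ 0`
    (hM : LinearMap.range s0 ≠ ⊤) :
    ∃ rs : List Q, (∀ r ∈ rs, r ∈ IsLocalRing.maximalIdeal Q) ∧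
      RingTheory.Sequence.IsRegular (F1 ⧸ LinearMap.range s0) rs ∧
      (rs.length : WithBot (WithTop ℕ)) = ringKrullDim (Q ⧸ Ideal.span {f}) := by
  classical
  obtain ⟨s, hs, hcard⟩ := hreg
  have hR : RegDim s.card Q := by
    refine ⟨⟨fun i => (s.equivFin.symm i : Q), ?_⟩, le_of_eq hcard⟩
    rw [← hs]
    congr 1
    ext y
    constructor
    · rintro ⟨i, rfl⟩
      exact (s.equivFin.symm i).2
    · intro hy
      exact ⟨s.equivFin ⟨y, hy⟩, by simp⟩
  have hdom := hR.isDomain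
  have hfm : f ∈ IsLocalRing.maximalIdeal Q := by
    rw [IsLocalRing.mem_maximalIdeal]
    intro hu
    apply hM
    rw [eq_top_iff]
    intro y _
    obtain ⟨u, hu⟩ := hu
    refine ⟨s1 ((↑u⁻¹ : Q) • y), ?_⟩
    have := LinearMap.congr_fun h01 ((↑u⁻¹ : Q) • y)
    simp only [LinearMap.comp_apply, LinearMap.smul_apply, LinearMap.id_apply] at this
    rw [this, ← hu, smul_smul, Units.mul_inv, one_smul]
  have hdim := ringKrullDim_quotient_span_singleton_succ_eq_ringKrullDim
    (IsSMulRegular.of_ne_zero (M := Q) hf) hfm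
  have hMn : Nontrivial (F1 ⧸ LinearMap.range s0) := Submodule.Quotient.nontrivial_iff.mpr hM
  rcases hn : s.card with _ | n
  · exfalso
    rw [hn] at hR
    obtain ⟨⟨v, hv⟩, -⟩ := hR
    have hb : IsLocalRing.maximalIdeal Q = ⊥ := by rw [← hv]; simp
    rw [hb] at hfm
    exact hf (by simpa using hfm)
  · rw [hn] at hR
    obtain ⟨rs, hrs, hw, hlen⟩ := mf_aux n Q hR f hf F0 F1 (F1 ⧸ LinearMap.range s0) s0 s1
      (LinearMap.range s0).mkQ (fun u => LinearMap.congr_fun h10 u)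
      (LinearMap.exact_map_mkQ_range s0) (Submodule.mkQ_surjective _)
    refine ⟨rs, hrs, .of_isWeaklyRegular_of_mem_maximalIdeal _ hrs hw, ?_⟩
    rw [hlen]
    rw [← hcard, hn] at hdim
    generalize ringKrullDim (Q ⧸ Ideal.span {f}) = d at hdim ⊢
    have h2 : d + 1 = ((n : ℕ) : WithBot ℕ∞) + 1 := by
      rw [hdim]; push_cast; rfl
    exact le_antisymm (add1_le h2.ge) (add1_le h2.le)
end
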